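/- arXiv:2602.22084 — 5 statements merged into one kernel-verified Lean document; each statement's English description precedes it below -/
import Mathlib

section
/- Let A ∈ ℂ^{n×n} be Hermitian and B ∈ ℂ^{n×n} be skew-Hermitian (Bᴴ = −B), and set E = AB − BA (which is Hermitian). For a Hermitian matrix M, let λ_1^↑(M) ≤ λ_2^↑(M) ≤ … ≤ λ_n^↑(M) denote its eigenvalues in nondecreasing order, counted with multiplicity. Then for every i = 1, …, n: |λ_i^↑(A + E) − λ_i^↑(A)| ≤ ‖B‖ ‖E‖. -/
open Matrix

/-- The spectral norm (operator norm induced by the Euclidean norm) of a complex matrix. -/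
noncomputable def specNorm {m n : Type*} [Fintype m] [Fintype n] [DecidableEq n]
    (M : Matrix m n ℂ) : ℝ :=
  ‖LinearMap.toContinuousLinearMap (Matrix.toEuclideanLin M)‖

/-- The eigenvalues of a Hermitian matrix, listed in nondecreasing order with
multiplicity. -/
noncomputable def sortedEigs {n : ℕ} {A : Matrix (Fin n) (Fin n) ℂ} (hA : A.IsHermitian) :
    Fin n → ℝ :=
  hA.eigenvalues ∘ Tuple.sort hA.eigenvalues

open scoped InnerProductSpace Matrix.Norms.L2Operator

section Weyl

variable {V : Type*} [NormedAddCommGroup V] [InnerProductSpace ℂ V]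

/-- The quadratic form of a symmetric operator in an orthonormal basis of eigenvectors. -/
lemma LinearMap.IsSymmetric.re_inner_eq_sum {ι : Type*} [Fintype ι] {T : V →ₗ[ℂ] V}
    (hT : T.IsSymmetric) (b : OrthonormalBasis ι ℂ V) {μ : ι → ℝ}
    (hb : ∀ j, T (b j) = (μ j : ℂ) • b j) (x : V) :
    (⟪x, T x⟫_ℂ).re = ∑ j, μ j * ‖⟪b j, x⟫_ℂ‖ ^ 2 := by
  rw [← b.sum_inner_mul_inner x (T x), Complex.re_sum]
  refine Finset.sum_congr rfl fun j _ ↦ ?_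
  rw [← hT (b j) x, hb, inner_smul_left, Complex.conj_ofReal, mul_left_comm,
    ← inner_conj_symm x (b j), Complex.conj_mul', ← Complex.ofReal_pow, ← Complex.ofReal_mul,
    Complex.ofReal_re]

/-- There is a nonzero vector whose coordinates below `i` in one orthonormal basis and above `i`
in another one vanish. -/
lemma OrthonormalBasis.exists_ne_zero_inner_eq_zero {n : ℕ} (b c : OrthonormalBasis (Fin n) ℂ V)
    (i : Fin n) :
    ∃ x : V, x ≠ 0 ∧ (∀ j < i, ⟪b j, x⟫_ℂ = 0) ∧ ∀ j, i < j → ⟪c j, x⟫_ℂ = 0 := by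
  have : FiniteDimensional ℂ V := b.toBasis.finiteDimensional_of_finite
  let f : V →ₗ[ℂ] (Fin n → ℂ) := LinearMap.pi fun j ↦
    if j < i then (innerSL ℂ (b j)).toLinearMap
    else if i < j then (innerSL ℂ (c j)).toLinearMap else 0
  have hrank : Module.finrank ℂ V = Module.finrank ℂ (Fin n → ℂ) := by
    simp [Module.finrank_eq_card_basis b.toBasis]
  have hinj : ¬ Function.Injective f := fun h ↦ by
    obtain ⟨x, hx⟩ := (LinearMap.injective_iff_surjective_of_finrank_eq_finrank hrank).1 h
      (Pi.single i 1)
    simpa [f] using congrFun hx i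
  rw [← LinearMap.ker_eq_bot, Submodule.eq_bot_iff] at hinj
  push Not at hinj
  obtain ⟨x, hx, hx0⟩ := hinj
  refine ⟨x, hx0, fun j hj ↦ ?_, fun j hj ↦ ?_⟩
  · simpa [f, hj] using congrFun (LinearMap.mem_ker.1 hx) j
  · simpa [f, hj, hj.not_gt] using congrFun (LinearMap.mem_ker.1 hx) j

/-- Weyl's monotonicity principle for symmetric operators with ordered eigenvalues. -/
lemma LinearMap.IsSymmetric.eigenvalue_le_add {n : ℕ} {S T : V →ₗ[ℂ] V}
    (hS : S.IsSymmetric) (hT : T.IsSymmetric) (b c : OrthonormalBasis (Fin n) ℂ V)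
    {μ ν : Fin n → ℝ} (hμ : Monotone μ) (hν : Monotone ν)
    (hb : ∀ j, S (b j) = (μ j : ℂ) • b j) (hc : ∀ j, T (c j) = (ν j : ℂ) • c j) {r : ℝ}
    (h : ∀ x, (⟪x, S x⟫_ℂ).re ≤ (⟪x, T x⟫_ℂ).re + r * ‖x‖ ^ 2) (i : Fin n) :
    μ i ≤ ν i + r := by
  obtain ⟨x, hx0, hbx, hcx⟩ := b.exists_ne_zero_inner_eq_zero c i
  have hlow : μ i * ‖x‖ ^ 2 ≤ (⟪x, S x⟫_ℂ).re := by
    rw [hS.re_inner_eq_sum b hb, ← b.sum_sq_norm_inner_right x, Finset.mul_sum]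
    refine Finset.sum_le_sum fun j _ ↦ ?_
    rcases lt_or_ge j i with hj | hj
    · simp [hbx j hj]
    · gcongr
      exact hμ hj
  have hup : (⟪x, T x⟫_ℂ).re ≤ ν i * ‖x‖ ^ 2 := by
    rw [hT.re_inner_eq_sum c hc, ← c.sum_sq_norm_inner_right x, Finset.mul_sum]
    refine Finset.sum_le_sum fun j _ ↦ ?_
    rcases lt_or_ge i j with hj | hj
    · simp [hcx j hj]
    · gcongr
      exact hν hj
  have hpos : 0 < ‖x‖ ^ 2 := by positivity
  refine le_of_mul_le_mul_right ?_ hpos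
  linarith [h x]

end Weyl

namespace Matrix

variable {n : ℕ}

lemma specNorm_eq_norm (M : Matrix (Fin n) (Fin n) ℂ) : specNorm M = ‖M‖ := rfl

lemma IsHermitian.sortedEigs_le_add {M N : Matrix (Fin n) (Fin n) ℂ} (hM : M.IsHermitian)
    (hN : N.IsHermitian) (i : Fin n) : sortedEigs hM i ≤ sortedEigs hN i + ‖M - N‖ := by
  have key {P : Matrix (Fin n) (Fin n) ℂ} (hP : P.IsHermitian) (j : Fin n) :
      toEuclideanLin P
          (hP.eigenvectorBasis.reindex (Tuple.sort hP.eigenvalues).symm j) =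
        (sortedEigs hP j : ℂ) •
          hP.eigenvectorBasis.reindex (Tuple.sort hP.eigenvalues).symm j := by
    rw [OrthonormalBasis.reindex_apply, Equiv.symm_symm, toLpLin_apply,
      hP.mulVec_eigenvectorBasis]
    rfl
  refine LinearMap.IsSymmetric.eigenvalue_le_add (isSymmetric_toEuclideanLin_iff.mpr hM)
    (isSymmetric_toEuclideanLin_iff.mpr hN) _ _ (Tuple.monotone_sort hM.eigenvalues)
    (Tuple.monotone_sort hN.eigenvalues) (key hM) (key hN) (fun x ↦ ?_) i
  have hsub : (⟪x, toEuclideanLin (M - N) x⟫_ℂ).re ≤ ‖M - N‖ * ‖x‖ ^ 2 := by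
    calc (⟪x, toEuclideanLin (M - N) x⟫_ℂ).re
        ≤ ‖x‖ * ‖toEuclideanLin (M - N) x‖ := re_inner_le_norm (𝕜 := ℂ) _ _
      _ ≤ ‖x‖ * (‖M - N‖ * ‖x‖) := by
        gcongr
        exact l2_opNorm_mulVec (M - N) x
      _ = ‖M - N‖ * ‖x‖ ^ 2 := by ring
  rw [map_sub, LinearMap.sub_apply, inner_sub_right, Complex.sub_re] at hsub
  linarith

/-- Weyl's perturbation inequality. -/
lemma IsHermitian.abs_sortedEigs_sub_le {M N : Matrix (Fin n) (Fin n) ℂ} (hM : M.IsHermitian)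
    (hN : N.IsHermitian) (i : Fin n) : |sortedEigs hM i - sortedEigs hN i| ≤ ‖M - N‖ := by
  have h₁ := hM.sortedEigs_le_add hN i
  have h₂ := hN.sortedEigs_le_add hM i
  rw [norm_sub_rev] at h₂
  exact abs_le.2 ⟨by linarith, by linarith⟩

lemma IsHermitian.sortedEigs_congr {M N : Matrix (Fin n) (Fin n) ℂ} (hM : M.IsHermitian)
    (hN : N.IsHermitian) (h : M.charpoly = N.charpoly) : sortedEigs hM = sortedEigs hN := by
  unfold sortedEigs
  rw [(hM.eigenvalues_eq_eigenvalues_iff hN).2 h]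

/-- Subtracting a skew-Hermitian matrix from the identity gives an expanding matrix. -/
lemma norm_le_norm_one_sub_of_skew {C : Matrix (Fin n) (Fin n) ℂ} (hC : Cᴴ = -C)
    (x : EuclideanSpace ℂ (Fin n)) : ‖x‖ ≤ ‖toEuclideanLin (1 - C) x‖ := by
  have hskew : (⟪x, toEuclideanLin C x⟫_ℂ).re = 0 := by
    have h : ⟪toEuclideanLin C x, x⟫_ℂ = -⟪x, toEuclideanLin C x⟫_ℂ := by
      rw [← LinearMap.adjoint_inner_right, ← toEuclideanLin_conjTranspose_eq_adjoint, hC,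
        map_neg, LinearMap.neg_apply, inner_neg_right]
    have h' := congrArg Complex.re h
    rw [← inner_conj_symm, Complex.conj_re, Complex.neg_re] at h'
    linarith
  have hsq := norm_sub_sq (𝕜 := ℂ) x (toEuclideanLin C x)
  have hone : toEuclideanLin (1 - C) x = x - toEuclideanLin C x := by
    simp [map_sub, toLpLin_apply]
  rw [RCLike.re_eq_complex_re, hskew] at hsq
  rw [hone]
  refine le_of_sq_le_sq ?_ (norm_nonneg _)
  nlinarith [sq_nonneg ‖toEuclideanLin C x‖]

/-- The resolvent of a skew-Hermitian matrix is a contraction. -/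
lemma exists_inverse_one_sub_of_skew {C : Matrix (Fin n) (Fin n) ℂ} (hC : Cᴴ = -C) :
    ∃ K : Matrix (Fin n) (Fin n) ℂ, K * (1 - C) = 1 ∧ (1 - C) * K = 1 ∧ ‖K‖ ≤ 1 := by
  have hunit : IsUnit (1 - C) := by
    rw [← mulVec_injective_iff_isUnit, ← coe_mulVecLin, ← LinearMap.ker_eq_bot,
      Submodule.eq_bot_iff]
    intro v hv
    have h := norm_le_norm_one_sub_of_skew hC (WithLp.toLp 2 v)
    have hv' : (1 - C) *ᵥ v = 0 := hv
    rw [toLpLin_toLp, toLin'_apply, hv'] at h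
    simpa using h
  obtain ⟨u, hu⟩ := hunit
  refine ⟨(u⁻¹ : (Matrix (Fin n) (Fin n) ℂ)ˣ), by simp [← hu], by simp [← hu], ?_⟩
  refine ContinuousLinearMap.opNorm_le_bound _ zero_le_one fun x ↦ ?_
  rw [one_mul]
  refine (norm_le_norm_one_sub_of_skew hC _).trans_eq ?_
  simp [toLpLin_apply, ← hu]

end Matrix

/-- for a Hermitian `A` and skew-Hermitian `B`, the eigenvalues of
`A + (AB - BA)` deviate from those of `A` by at most `‖B‖‖E‖`. -/
theorem stmt_9 {n : ℕ} (A B : Matrix (Fin n) (Fin n) ℂ)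
    (hA : A.IsHermitian) (hB : Bᴴ = -B)
    (hE : (A * B - B * A).IsHermitian)
    (hAE : (A + (A * B - B * A)).IsHermitian) :
    ∀ i : Fin n,
      |sortedEigs hAE i - sortedEigs hA i| ≤ specNorm B * specNorm (A * B - B * A) := by
  intro i
  obtain ⟨C, rfl⟩ : ∃ C, B = C + C := ⟨(1 / 2 : ℂ) • B, by rw [← add_smul]; norm_num⟩
  have hC : Cᴴ = -C := by
    have h : (2 : ℂ) • Cᴴ = (2 : ℂ) • (-C) := by
      rw [two_smul, two_smul, ← conjTranspose_add, hB, neg_add]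
    exact smul_right_injective _ (two_ne_zero (α := ℂ)) h
  obtain ⟨K, hKX, hXK, hK⟩ := exists_inverse_one_sub_of_skew hC
  have hKY : (1 + C) * Kᴴ = 1 := by
    simpa [hC] using congrArg conjTranspose hKX
  have hYK : Kᴴ * (1 + C) = 1 := by
    simpa [hC] using congrArg conjTranspose hXK
  generalize hEdef : A * (C + C) - (C + C) * A = E at *
  -- The Cayley transform of `C` conjugates `A` to `A + Kᴴ * E * K`.
  have hH : (A + Kᴴ * E * K).IsHermitian := hA.add (isHermitian_conjTranspose_mul_mul K hE)
  have hconj : A + Kᴴ * E * K = Kᴴ * ((1 - C) * A * (1 + C)) * K := by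
    have h : (1 - C) * A * (1 + C) = (1 + C) * A * (1 - C) + E := by
      rw [← hEdef]; noncomm_ring
    rw [h, mul_add, add_mul]
    congr 1
    calc A = (Kᴴ * (1 + C)) * A * ((1 - C) * K) := by rw [hYK, hXK, one_mul, mul_one]
      _ = _ := by noncomm_ring
  have hcancel : (1 + C) * K * (Kᴴ * (1 - C)) = 1 := by
    have hcomm : (1 + C) * (1 - C) = (1 - C) * (1 + C) := by noncomm_ring
    have h₁ : (1 + C) * K = K * (1 + C) := by
      calc (1 + C) * K = K * ((1 - C) * (1 + C)) * K := by
            rw [← mul_assoc, hKX, one_mul]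
        _ = K * (1 + C) * ((1 - C) * K) := by rw [← hcomm]; noncomm_ring
        _ = K * (1 + C) := by rw [hXK, mul_one]
    calc (1 + C) * K * (Kᴴ * (1 - C)) = K * ((1 + C) * Kᴴ) * (1 - C) := by
          rw [h₁]; noncomm_ring
      _ = 1 := by rw [hKY, mul_one, hKX]
  have hchar : (A + Kᴴ * E * K).charpoly = A.charpoly := by
    rw [hconj]
    calc (Kᴴ * ((1 - C) * A * (1 + C)) * K).charpoly
        = ((Kᴴ * (1 - C)) * (A * ((1 + C) * K))).charpoly := by simp only [mul_assoc]
      _ = (A * ((1 + C) * K * (Kᴴ * (1 - C)))).charpoly := by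
        rw [charpoly_mul_comm]; simp only [mul_assoc]
      _ = A.charpoly := by rw [hcancel, mul_one]
  rw [← hH.sortedEigs_congr hA hchar, specNorm_eq_norm, specNorm_eq_norm]
  refine (hAE.abs_sortedEigs_sub_le hH i).trans ?_
  have hK' : ‖Kᴴ‖ ≤ 1 := (l2_opNorm_conjTranspose K).trans_le hK
  have hCC : ‖C + C‖ = 2 * ‖C‖ := by rw [← two_smul ℝ C, norm_smul]; norm_num
  have hsplit : A + E - (A + Kᴴ * E * K) = C * Kᴴ * E - Kᴴ * E * (C * K) := by
    have h₁ : C * Kᴴ = 1 - Kᴴ := by rw [← hKY]; noncomm_ring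
    have h₂ : C * K = K - 1 := by rw [← hXK]; noncomm_ring
    rw [h₁, h₂]; noncomm_ring
  rw [hsplit, hCC]
  calc ‖C * Kᴴ * E - Kᴴ * E * (C * K)‖
      ≤ ‖C * Kᴴ * E‖ + ‖Kᴴ * E * (C * K)‖ := norm_sub_le _ _
    _ ≤ ‖C‖ * ‖Kᴴ‖ * ‖E‖ + ‖Kᴴ‖ * ‖E‖ * (‖C‖ * ‖K‖) := by
      gcongr
      · exact norm_mul₃_le
      · refine (norm_mul_le _ _).trans ?_
        gcongr <;> exact norm_mul_le _ _
    _ ≤ ‖C‖ * 1 * ‖E‖ + 1 * ‖E‖ * (‖C‖ * 1) := by gcongr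
    _ = 2 * ‖C‖ * ‖E‖ := by ring
end

section
/- Let λ_1 ∈ ℝ, m, k ∈ ℕ, and let D ∈ ℂ^{(m+k)×(m+k)} be the block-diagonal Hermitian matrix with blocks D_1 = λ_1 I_m and a real diagonal matrix D_2 ∈ ℝ^{k×k}. Set gap = min_j |λ_1 − D_2(j,j)| and assume gap > 0. Let E_1 ∈ ℂ^{m×k}, define B_1 ∈ ℂ^{m×k} by B_1(p,j) = E_1(p,j)/(λ_1 − D_2(j,j)) (so λ_1 B_1 − B_1 D_2 = E_1), and let E ∈ ℂ^{(m+k)×(m+k)} be the Hermitian matrix with zero diagonal blocks and off-diagonal blocks E_1 (upper right) and E_1ᴴ (lower left). Assume ‖E_1‖ < gap. Then for every index i such that the i-th smallest eigenvalue (with multiplicity) of D equals λ_1, the i-th smallest eigenvalue of D + E, denoted λ_i^↑(D+E), satisfies |λ_i^↑(D+E) − λ_1| ≤ (1/2)‖B_1 E_1ᴴ + E_1 B_1ᴴ‖ + (2/3)‖E_1‖²‖B_1‖/(gap − ‖E_1‖). -/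
open Matrix

/-- The eigenvalues of a Hermitian matrix indexed by \`Fin m ⊕ Fin k\`, listed in
nondecreasing order with multiplicity. -/
noncomputable def sortedEigsSum {m k : ℕ}
    {A : Matrix (Fin m ⊕ Fin k) (Fin m ⊕ Fin k) ℂ} (hA : A.IsHermitian) :
    Fin (m + k) → ℝ :=
  (hA.eigenvalues ∘ finSumFinEquiv.symm) ∘
    Tuple.sort (hA.eigenvalues ∘ finSumFinEquiv.symm)

open scoped InnerProductSpace

theorem norm_toEuclideanLin_le_specNorm {m n : Type*} [Fintype m] [Fintype n] [DecidableEq n]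
    (M : Matrix m n ℂ) (x : EuclideanSpace ℂ n) :
    ‖Matrix.toEuclideanLin M x‖ ≤ specNorm M * ‖x‖ :=
  (LinearMap.toContinuousLinearMap (Matrix.toEuclideanLin M)).le_opNorm x

theorem specNorm_nonneg {m n : Type*} [Fintype m] [Fintype n] [DecidableEq n]
    (M : Matrix m n ℂ) : 0 ≤ specNorm M :=
  norm_nonneg _

open scoped Matrix.Norms.L2Operator in
theorem specNorm_conjTranspose {m n : Type*} [Fintype m] [Fintype n] [DecidableEq m]
    [DecidableEq n] (M : Matrix m n ℂ) : specNorm Mᴴ = specNorm M :=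
  Matrix.l2_opNorm_conjTranspose M

theorem re_inner_toEuclideanLin_eq_sum {n : Type*} [Fintype n] [DecidableEq n]
    {A : Matrix n n ℂ} (hA : A.IsHermitian) (x : EuclideanSpace ℂ n) :
    RCLike.re ⟪x, Matrix.toEuclideanLin A x⟫_ℂ =
      ∑ j, hA.eigenvalues j * ‖⟪hA.eigenvectorBasis j, x⟫_ℂ‖ ^ 2 := by
  have hsym := Matrix.isSymmetric_toEuclideanLin_iff.2 hA
  rw [← hA.eigenvectorBasis.sum_inner_mul_inner, map_sum]
  refine Finset.sum_congr rfl fun j _ => ?_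
  have hev : Matrix.toEuclideanLin A (hA.eigenvectorBasis j) =
      (hA.eigenvalues j : ℂ) • hA.eigenvectorBasis j := by
    ext p
    have := congrFun (hA.mulVec_eigenvectorBasis j) p
    simpa [Matrix.toLpLin_apply] using this
  rw [← hsym, hev, inner_smul_left, Complex.conj_ofReal, mul_left_comm, ← inner_conj_symm x,
    RCLike.conj_mul, ← RCLike.ofReal_pow]
  exact (RCLike.re_ofReal_mul (hA.eigenvalues j) _).trans (by rw [RCLike.ofReal_re])

/-- Weyl's monotonicity principle: if the quadratic form of `A` is at most that of `B + c`, then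
so are the sorted eigenvalues. -/
theorem sortedEigsSum_le_add {m k : ℕ} {A B : Matrix (Fin m ⊕ Fin k) (Fin m ⊕ Fin k) ℂ}
    (hA : A.IsHermitian) (hB : B.IsHermitian) {c : ℝ}
    (h : ∀ x, RCLike.re ⟪x, Matrix.toEuclideanLin A x⟫_ℂ ≤
      RCLike.re ⟪x, Matrix.toEuclideanLin B x⟫_ℂ + c * ‖x‖ ^ 2) (i : Fin (m + k)) :
    sortedEigsSum hA i ≤ sortedEigsSum hB i + c := by
  let σ := (Tuple.sort (hA.eigenvalues ∘ finSumFinEquiv.symm)).trans finSumFinEquiv.symm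
  let τ := (Tuple.sort (hB.eigenvalues ∘ finSumFinEquiv.symm)).trans finSumFinEquiv.symm
  have hmA : Monotone (sortedEigsSum hA) := Tuple.monotone_sort _
  have hmB : Monotone (sortedEigsSum hB) := Tuple.monotone_sort _
  let f : EuclideanSpace ℂ (Fin m ⊕ Fin k) →ₗ[ℂ] ({j // j ≠ i} → ℂ) :=
    LinearMap.pi fun j => if j.1 < i then (innerSL ℂ (hA.eigenvectorBasis (σ j))).toLinearMap
      else (innerSL ℂ (hB.eigenvectorBasis (τ j))).toLinearMap
  have hker : LinearMap.ker f ≠ ⊥ := by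
    apply LinearMap.ker_ne_bot_of_finrank_lt
    have := i.pos
    simp
    omega
  obtain ⟨x, hx, hx0⟩ := Submodule.exists_mem_ne_zero_of_ne_bot hker
  have hfx : ∀ j : {j // j ≠ i}, f x j = 0 := fun j => congrFun hx j
  have hxA : ∀ j < i, ⟪hA.eigenvectorBasis (σ j), x⟫_ℂ = 0 := fun j hj => by
    have := hfx ⟨j, hj.ne⟩
    simpa [f, hj] using this
  have hxB : ∀ j, i < j → ⟪hB.eigenvectorBasis (τ j), x⟫_ℂ = 0 := fun j hj => by
    have := hfx ⟨j, hj.ne'⟩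
    simpa [f, hj.le.not_gt] using this
  have h1 : sortedEigsSum hA i * ‖x‖ ^ 2 ≤ RCLike.re ⟪x, Matrix.toEuclideanLin A x⟫_ℂ := by
    rw [re_inner_toEuclideanLin_eq_sum hA, ← hA.eigenvectorBasis.sum_sq_norm_inner_right,
      ← σ.sum_comp, ← σ.sum_comp, Finset.mul_sum]
    refine Finset.sum_le_sum fun j _ => ?_
    rcases lt_or_ge j i with hj | hj
    · simp [hxA j hj]
    · exact mul_le_mul_of_nonneg_right (hmA hj) (by positivity)
  have h2 : RCLike.re ⟪x, Matrix.toEuclideanLin B x⟫_ℂ ≤ sortedEigsSum hB i * ‖x‖ ^ 2 := by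
    rw [re_inner_toEuclideanLin_eq_sum hB, ← hB.eigenvectorBasis.sum_sq_norm_inner_right,
      ← τ.sum_comp, ← τ.sum_comp, Finset.mul_sum]
    refine Finset.sum_le_sum fun j _ => ?_
    rcases lt_or_ge i j with hj | hj
    · simp [hxB j hj]
    · exact mul_le_mul_of_nonneg_right (hmB hj) (by positivity)
  have hpos : 0 < ‖x‖ ^ 2 := by positivity
  nlinarith [h x]

theorem inner_toEuclideanLin_conjTranspose_left {m n : Type*} [Fintype m] [Fintype n]
    [DecidableEq m] [DecidableEq n] (M : Matrix m n ℂ) (x : EuclideanSpace ℂ m)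
    (y : EuclideanSpace ℂ n) :
    ⟪Matrix.toEuclideanLin Mᴴ x, y⟫_ℂ = ⟪x, Matrix.toEuclideanLin M y⟫_ℂ := by
  rw [Matrix.toEuclideanLin_conjTranspose_eq_adjoint, LinearMap.adjoint_inner_left]

theorem re_inner_fromBlocks_offDiagonal {m n : Type*} [Fintype m] [Fintype n] [DecidableEq m]
    [DecidableEq n] (M : Matrix m n ℂ) (v : EuclideanSpace ℂ m) (w : EuclideanSpace ℂ n)
    (x : EuclideanSpace ℂ (m ⊕ n)) (hv : ∀ p, x (Sum.inl p) = v p)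
    (hw : ∀ j, x (Sum.inr j) = w j) :
    RCLike.re ⟪x, Matrix.toEuclideanLin (Matrix.fromBlocks 0 M Mᴴ 0) x⟫_ℂ =
      2 * RCLike.re ⟪v, Matrix.toEuclideanLin M w⟫_ℂ := by
  have h : ⟪x, Matrix.toEuclideanLin (Matrix.fromBlocks 0 M Mᴴ 0) x⟫_ℂ =
      ⟪v, Matrix.toEuclideanLin M w⟫_ℂ + ⟪w, Matrix.toEuclideanLin Mᴴ v⟫_ℂ := by
    simp [PiLp.inner_apply, Matrix.toLpLin_apply, Matrix.mulVec, dotProduct, hv, hw]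
  rw [h, map_add, ← inner_conj_symm w, RCLike.conj_re, inner_toEuclideanLin_conjTranspose_left]
  ring

theorem abs_re_inner_fromBlocks_offDiagonal_le {m n : Type*} [Fintype m] [Fintype n]
    [DecidableEq m] [DecidableEq n] (M : Matrix m n ℂ) (x : EuclideanSpace ℂ (m ⊕ n)) :
    |RCLike.re ⟪x, Matrix.toEuclideanLin (Matrix.fromBlocks 0 M Mᴴ 0) x⟫_ℂ| ≤
      specNorm M * ‖x‖ ^ 2 := by
  let v : EuclideanSpace ℂ m := WithLp.toLp 2 fun p => x (Sum.inl p)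
  let w : EuclideanSpace ℂ n := WithLp.toLp 2 fun j => x (Sum.inr j)
  have hx : ‖x‖ ^ 2 = ‖v‖ ^ 2 + ‖w‖ ^ 2 := by
    simp [EuclideanSpace.norm_sq_eq, v, w]
  rw [re_inner_fromBlocks_offDiagonal M v w x (fun _ => rfl) (fun _ => rfl), hx, abs_mul, abs_two]
  have h1 : |RCLike.re ⟪v, Matrix.toEuclideanLin M w⟫_ℂ| ≤ ‖v‖ * (specNorm M * ‖w‖) :=
    (RCLike.abs_re_le_norm _).trans ((norm_inner_le_norm _ _).trans
      (mul_le_mul_of_nonneg_left (norm_toEuclideanLin_le_specNorm M w) (norm_nonneg _)))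
  nlinarith [mul_nonneg (specNorm_nonneg M) (sq_nonneg (‖v‖ - ‖w‖))]

theorem mul_add_le_sq_of_secular_eq_of_nonneg {ι : Type*} [Fintype ι] {a c : ι → ℝ}
    {δ e g N : ℝ} (hN : 0 < N) (hc : ∀ j, g ≤ |c j|) (hδ : 0 ≤ δ) (hδg : δ < g)
    (hsec : δ * N = ∑ j, a j ^ 2 / (δ - c j)) (ha : ∑ j, a j ^ 2 ≤ e ^ 2 * N) :
    δ * (g + δ) ≤ e ^ 2 := by
  have hgδ : 0 < g + δ := by linarith
  have h : δ * N ≤ (∑ j, a j ^ 2) / (g + δ) := by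
    rw [hsec, Finset.sum_div]
    refine Finset.sum_le_sum fun j _ => ?_
    rcases le_abs'.1 (hc j) with h | h
    · exact div_le_div_of_nonneg_left (sq_nonneg _) hgδ (by linarith)
    · exact (div_nonpos_of_nonneg_of_nonpos (sq_nonneg _) (by linarith)).trans
        (div_nonneg (sq_nonneg _) hgδ.le)
  rw [le_div_iff₀ hgδ] at h
  nlinarith

theorem abs_mul_add_le_sq_of_secular_eq {ι : Type*} [Fintype ι] {a c : ι → ℝ}
    {δ e g N : ℝ} (hN : 0 < N) (hc : ∀ j, g ≤ |c j|) (hδg : |δ| < g)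
    (hsec : δ * N = ∑ j, a j ^ 2 / (δ - c j)) (ha : ∑ j, a j ^ 2 ≤ e ^ 2 * N) :
    |δ| * (g + |δ|) ≤ e ^ 2 := by
  rcases le_total 0 δ with h | h
  · rw [abs_of_nonneg h] at hδg ⊢
    exact mul_add_le_sq_of_secular_eq_of_nonneg hN hc h hδg hsec ha
  · rw [abs_of_nonpos h] at hδg ⊢
    refine mul_add_le_sq_of_secular_eq_of_nonneg (c := fun j => -c j) hN (by simpa using hc)
      (by linarith) hδg ?_ ha
    rw [neg_mul, hsec, ← Finset.sum_neg_distrib]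
    refine Finset.sum_congr rfl fun j _ => ?_
    rw [← div_neg]
    congr 1
    ring

theorem div_gap_sub_le {δ e g : ℝ} (hδ : 0 ≤ δ) (he : 0 ≤ e) (heg : e < g)
    (h : δ * (g + δ) ≤ e ^ 2) : δ / (g - δ) ≤ 2 / 3 * e / (g - e) := by
  have h1 : δ ≤ 2 / 3 * e := by
    by_contra! hlt
    nlinarith
  exact div_le_div₀ (by linarith) h1 (by linarith) (by linarith)

/-- The two block equations of an eigenvector `(v, w)` with eigenvalue `δ` of the Hermitian matrix
with blocks `0, X, Xᴴ, diagonal c` bound `δ` by its second-order term and a third-order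
remainder. -/
theorem abs_eigenvalue_le_of_block_eqs {m n : Type*} [Fintype m] [Fintype n] [DecidableEq m]
    [DecidableEq n] (X B : Matrix m n ℂ) {c : n → ℝ} {δ g : ℝ} (hc : ∀ j, g ≤ |c j|)
    (hX : specNorm X < g) (hδ : |δ| ≤ specNorm X) (hB : ∀ p j, B p j = X p j / (-(c j) : ℂ))
    {v : EuclideanSpace ℂ m} {w : EuclideanSpace ℂ n} (hv0 : v ≠ 0)
    (hv : Matrix.toEuclideanLin X w = (δ : ℂ) • v)
    (hw : ∀ j, Matrix.toEuclideanLin Xᴴ v j = ((δ - c j : ℝ) : ℂ) * w j) :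
    |δ| ≤ (1 / 2) * specNorm (B * Xᴴ + X * Bᴴ) +
      (2 / 3) * specNorm X ^ 2 * specNorm B / (g - specNorm X) := by
  set y := Matrix.toEuclideanLin Xᴴ v with hy
  set z := Matrix.toEuclideanLin Bᴴ v with hz
  have hδg : |δ| < g := hδ.trans_lt hX
  have hδ0 : 0 ≤ |δ| := abs_nonneg δ
  have hgδ : ∀ j, g - |δ| ≤ |δ - c j| := fun j => by
    have := abs_sub_abs_le_abs_sub (c j) δ
    rw [abs_sub_comm] at this
    linarith [hc j]
  have hne : ∀ j, δ - c j ≠ 0 := fun j => abs_pos.1 (by linarith [hgδ j])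
  have hc0 : ∀ j, c j ≠ 0 := fun j => abs_pos.1 (by linarith [hc j])
  have hN : 0 < ‖v‖ ^ 2 := by positivity
  have hyn : ‖y‖ ≤ specNorm X * ‖v‖ := by
    simpa [specNorm_conjTranspose] using norm_toEuclideanLin_le_specNorm Xᴴ v
  have hzn : ‖z‖ ≤ specNorm B * ‖v‖ := by
    simpa [specNorm_conjTranspose] using norm_toEuclideanLin_le_specNorm Bᴴ v
  have hzy : ∀ j, z j = ((-(c j)⁻¹ : ℝ) : ℂ) * y j := fun j => by
    simp only [hz, hy, Matrix.toLpLin_apply, Matrix.mulVec, dotProduct, Finset.mul_sum]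
    refine Finset.sum_congr rfl fun p _ => ?_
    simp [hB, div_eq_mul_inv, inv_neg]
    ring
  have hwy : ∀ j, w j = (((δ - c j)⁻¹ : ℝ) : ℂ) * y j := fun j => by
    rw [hw j, ← mul_assoc, ← Complex.ofReal_mul, inv_mul_cancel₀ (hne j), Complex.ofReal_one,
      one_mul]
  have hsec : δ * ‖v‖ ^ 2 = ∑ j, ‖y j‖ ^ 2 / (δ - c j) := by
    have h := inner_toEuclideanLin_conjTranspose_left X v w
    rw [hv, inner_smul_right, inner_self_eq_norm_sq_to_K, ← hy, PiLp.inner_apply] at h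
    have h2 : ∀ j, ⟪y j, w j⟫_ℂ = ((‖y j‖ ^ 2 / (δ - c j) : ℝ) : ℂ) := fun j => by
      rw [hwy j, RCLike.inner_apply, mul_assoc, RCLike.mul_conj, div_eq_inv_mul]
      push_cast
      rfl
    simp only [h2] at h
    refine Complex.ofReal_injective ?_
    rw [Complex.ofReal_sum, h]
    push_cast
    rfl
  have hquad : |∑ j, ‖y j‖ ^ 2 / c j| ≤
      1 / 2 * specNorm (B * Xᴴ + X * Bᴴ) * ‖v‖ ^ 2 := by
    have h1 : ⟪z, y⟫_ℂ = ((-∑ j, ‖y j‖ ^ 2 / c j : ℝ) : ℂ) := by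
      rw [PiLp.inner_apply, ← Finset.sum_neg_distrib, Complex.ofReal_sum]
      refine Finset.sum_congr rfl fun j _ => ?_
      rw [hzy j, RCLike.inner_apply, map_mul, Complex.conj_ofReal, mul_left_comm, RCLike.mul_conj,
        div_eq_inv_mul]
      push_cast
      simp
    have h2 : ⟪v, Matrix.toEuclideanLin (B * Xᴴ + X * Bᴴ) v⟫_ℂ = ⟪z, y⟫_ℂ + ⟪y, z⟫_ℂ := by
      rw [hz, hy, inner_toEuclideanLin_conjTranspose_left,
        inner_toEuclideanLin_conjTranspose_left, ← inner_add_right]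
      congr 1
      simp [Matrix.toLpLin_apply, Matrix.mulVec_mulVec]
    rw [← inner_conj_symm y z, h1, Complex.conj_ofReal, ← Complex.ofReal_add] at h2
    have h3 := norm_inner_le_norm (𝕜 := ℂ) v (Matrix.toEuclideanLin (B * Xᴴ + X * Bᴴ) v)
    rw [h2, Complex.norm_real, Real.norm_eq_abs, ← two_mul, abs_mul, abs_two, abs_neg] at h3
    have h4 := norm_toEuclideanLin_le_specNorm (B * Xᴴ + X * Bᴴ) v
    nlinarith [norm_nonneg v]
  have hrem : |∑ j, ‖y j‖ ^ 2 / (c j * (δ - c j))| ≤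
      specNorm X * specNorm B * ‖v‖ ^ 2 / (g - |δ|) := by
    calc _ ≤ ∑ j, ‖z j‖ * ‖y j‖ / (g - |δ|) := by
          refine (Finset.abs_sum_le_sum_abs _ _).trans (Finset.sum_le_sum fun j _ => ?_)
          have : ‖z j‖ = ‖y j‖ / |c j| := by
            rw [hzy, norm_mul, Complex.norm_real, Real.norm_eq_abs, abs_neg, abs_inv,
              div_eq_inv_mul]
          rw [this, abs_div, abs_mul, abs_of_nonneg (sq_nonneg ‖y j‖), div_mul_eq_mul_div, ← sq,
            ← div_div]
          exact div_le_div_of_nonneg_left (by positivity) (by linarith) (hgδ j)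
      _ ≤ ‖z‖ * ‖y‖ / (g - |δ|) := by
          rw [← Finset.sum_div]
          refine div_le_div_of_nonneg_right ?_ (by linarith)
          rw [EuclideanSpace.norm_eq, EuclideanSpace.norm_eq]
          exact Real.sum_mul_le_sqrt_mul_sqrt _ _ _
      _ ≤ _ := by
          refine div_le_div_of_nonneg_right ?_ (by linarith)
          calc ‖z‖ * ‖y‖ ≤ (specNorm B * ‖v‖) * (specNorm X * ‖v‖) :=
                mul_le_mul hzn hyn (norm_nonneg _) ((norm_nonneg _).trans hzn)
            _ = _ := by ring
  have hsplit : δ * ‖v‖ ^ 2 =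
      -(∑ j, ‖y j‖ ^ 2 / c j) + δ * ∑ j, ‖y j‖ ^ 2 / (c j * (δ - c j)) := by
    rw [hsec, ← Finset.sum_neg_distrib, Finset.mul_sum, ← Finset.sum_add_distrib]
    refine Finset.sum_congr rfl fun j _ => ?_
    have := hne j
    have := hc0 j
    field_simp
    ring
  have hsmall : |δ| * (g + |δ|) ≤ specNorm X ^ 2 := by
    refine abs_mul_add_le_sq_of_secular_eq hN hc hδg hsec ?_
    rw [← EuclideanSpace.norm_sq_eq, ← mul_pow]
    exact pow_le_pow_left₀ (norm_nonneg _) hyn 2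
  have hratio := div_gap_sub_le hδ0 (specNorm_nonneg X) hX hsmall
  have hnonneg : 0 ≤ specNorm X * specNorm B * ‖v‖ ^ 2 :=
    mul_nonneg (mul_nonneg (specNorm_nonneg X) (specNorm_nonneg B)) hN.le
  refine le_of_mul_le_mul_right ?_ hN
  calc |δ| * ‖v‖ ^ 2 = |δ * ‖v‖ ^ 2| := by rw [abs_mul, abs_of_pos hN]
    _ ≤ |∑ j, ‖y j‖ ^ 2 / c j| + |δ| * |∑ j, ‖y j‖ ^ 2 / (c j * (δ - c j))| := by
        rw [hsplit, ← abs_neg (∑ j, ‖y j‖ ^ 2 / c j), ← abs_mul]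
        exact abs_add_le _ _
    _ ≤ 1 / 2 * specNorm (B * Xᴴ + X * Bᴴ) * ‖v‖ ^ 2 +
          |δ| * (specNorm X * specNorm B * ‖v‖ ^ 2 / (g - |δ|)) :=
        add_le_add hquad (mul_le_mul_of_nonneg_left hrem hδ0)
    _ = 1 / 2 * specNorm (B * Xᴴ + X * Bᴴ) * ‖v‖ ^ 2 +
          |δ| / (g - |δ|) * (specNorm X * specNorm B * ‖v‖ ^ 2) := by ring
    _ ≤ 1 / 2 * specNorm (B * Xᴴ + X * Bᴴ) * ‖v‖ ^ 2 +
          2 / 3 * specNorm X / (g - specNorm X) * (specNorm X * specNorm B * ‖v‖ ^ 2) :=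
        add_le_add_right (mul_le_mul_of_nonneg_right hratio hnonneg) _
    _ = _ := by ring

/-- eigenvalue bound in the `2×2` block-diagonal Hermitian case with
`D₁ = λ₁ I`. -/
theorem stmt_11 {m k : ℕ} (lam1 : ℝ) (d : Fin k → ℝ)
    (gap : ℝ) (hgap : gap = ⨅ j : Fin k, |lam1 - d j|) (hgap0 : 0 < gap)
    (E₁ B₁ : Matrix (Fin m) (Fin k) ℂ)
    (hB₁ : ∀ p j, B₁ p j = E₁ p j / ((lam1 : ℂ) - (d j : ℂ)))
    (D E : Matrix (Fin m ⊕ Fin k) (Fin m ⊕ Fin k) ℂ)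
    (hD : D = Matrix.fromBlocks ((lam1 : ℂ) • 1) 0 0 (Matrix.diagonal fun j => (d j : ℂ)))
    (hEdef : E = Matrix.fromBlocks 0 E₁ E₁ᴴ 0)
    (hE1small : specNorm E₁ < gap)
    (hHD : D.IsHermitian) (hHDE : (D + E).IsHermitian) :
    ∀ i : Fin (m + k), sortedEigsSum hHD i = lam1 →
      |sortedEigsSum hHDE i - lam1| ≤
        (1/2) * specNorm (B₁ * E₁ᴴ + E₁ * B₁ᴴ) +
          (2/3) * specNorm E₁ ^ 2 * specNorm B₁ / (gap - specNorm E₁) := by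
  intro i hi
  have hgapj : ∀ j, gap ≤ |d j - lam1| := fun j => by
    rw [hgap, abs_sub_comm]
    exact ciInf_le (Set.finite_range _).bddBelow j
  have hquad : ∀ x : EuclideanSpace ℂ (Fin m ⊕ Fin k),
      RCLike.re ⟪x, Matrix.toEuclideanLin (D + E) x⟫_ℂ =
        RCLike.re ⟪x, Matrix.toEuclideanLin D x⟫_ℂ +
          RCLike.re ⟪x, Matrix.toEuclideanLin E x⟫_ℂ := fun x => by
    rw [map_add, LinearMap.add_apply, inner_add_right, map_add]
  have hEx : ∀ x : EuclideanSpace ℂ (Fin m ⊕ Fin k),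
      |RCLike.re ⟪x, Matrix.toEuclideanLin E x⟫_ℂ| ≤ specNorm E₁ * ‖x‖ ^ 2 := fun x => by
    rw [hEdef]
    exact abs_re_inner_fromBlocks_offDiagonal_le E₁ x
  have hweyl : |sortedEigsSum hHDE i - lam1| ≤ specNorm E₁ := by
    have h1 := sortedEigsSum_le_add hHDE hHD (c := specNorm E₁)
      (fun x => by linarith [hquad x, (abs_le.1 (hEx x)).2]) i
    have h2 := sortedEigsSum_le_add hHD hHDE (c := specNorm E₁)
      (fun x => by linarith [hquad x, (abs_le.1 (hEx x)).1]) i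
    rw [abs_le]
    constructor <;> linarith
  obtain ⟨q, hq⟩ : ∃ q, hHDE.eigenvalues q = sortedEigsSum hHDE i := ⟨_, rfl⟩
  generalize sortedEigsSum hHDE i = μ at hq hweyl ⊢
  set u := hHDE.eigenvectorBasis q with hu
  have hu0 : u ≠ 0 := hHDE.eigenvectorBasis.orthonormal.ne_zero q
  have heig := hHDE.mulVec_eigenvectorBasis q
  rw [hq, ← hu] at heig
  let v : EuclideanSpace ℂ (Fin m) := WithLp.toLp 2 fun p => u (Sum.inl p)
  let w : EuclideanSpace ℂ (Fin k) := WithLp.toLp 2 fun j => u (Sum.inr j)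
  have hv : Matrix.toEuclideanLin E₁ w = ((μ - lam1 : ℝ) : ℂ) • v := by
    ext p
    have h := congrFun heig (Sum.inl p)
    simp [hD, hEdef, Matrix.mulVec, dotProduct, Matrix.one_apply] at h
    simp [Matrix.toLpLin_apply, Matrix.mulVec, dotProduct, v, w]
    linear_combination h
  have hw : ∀ j, Matrix.toEuclideanLin E₁ᴴ v j =
      ((μ - lam1 - (d j - lam1) : ℝ) : ℂ) * w j := fun j => by
    have h := congrFun heig (Sum.inr j)
    simp [hD, hEdef, Matrix.mulVec, dotProduct, Matrix.diagonal_apply] at h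
    simp [Matrix.toLpLin_apply, Matrix.mulVec, dotProduct, v, w]
    linear_combination h
  have hv0 : v ≠ 0 := fun h0 => hu0 <| by
    have hw0 : ∀ j, w j = 0 := fun j => by
      have h := hw j
      rw [h0, map_zero, PiLp.zero_apply, eq_comm, mul_eq_zero, Complex.ofReal_eq_zero,
        sub_eq_zero] at h
      refine h.resolve_left fun h => ?_
      have := hgapj j
      rw [← h] at this
      linarith
    ext (p | j)
    · exact congrArg (fun x : EuclideanSpace ℂ (Fin m) => x p) h0
    · exact hw0 j
  refine abs_eigenvalue_le_of_block_eqs E₁ B₁ hgapj hE1small hweyl (fun p j => ?_) hv0 hv hw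
  rw [hB₁]
  push_cast
  rw [neg_sub]
end

section
/- Let A ∈ ℝ^{n×n} be diagonal with pairwise distinct positive diagonal entries σ_1, …, σ_n, and let E ∈ ℝ^{n×n} have zero diagonal. Define S_1, S_2 ∈ ℝ^{n×n} by S_1(i,j) = (σ_j E(i,j) + σ_i E(j,i))/(σ_j² − σ_i²) and S_2(i,j) = −(σ_j E(j,i) + σ_i E(i,j))/(σ_j² − σ_i²) for i ≠ j, and S_1(i,i) = S_2(i,i) = 0. Then S_1 and S_2 are skew-symmetric and S_1 A + A S_2 = E. -/
open Matrix

/-- explicit skew-symmetric solution `S₁, S₂` of `S₁A + AS₂ = E` for a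
real diagonal matrix `A` with pairwise distinct positive diagonal entries and a zero
diagonal perturbation `E`. -/
theorem stmt_14 {n : ℕ} (A E S₁ S₂ : Matrix (Fin n) (Fin n) ℝ)
    (hAdiag : ∀ i j, i ≠ j → A i j = 0)
    (hpos : ∀ i, 0 < A i i)
    (hdist : Function.Injective fun i => A i i)
    (hE : ∀ i, E i i = 0)
    (hS₁ : ∀ i j, S₁ i j = if i = j then 0 else
      (A j j * E i j + A i i * E j i) / (A j j ^ 2 - A i i ^ 2))
    (hS₂ : ∀ i j, S₂ i j = if i = j then 0 else
      -((A j j * E j i + A i i * E i j) / (A j j ^ 2 - A i i ^ 2))) :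
    S₁ᵀ = -S₁ ∧ S₂ᵀ = -S₂ ∧ S₁ * A + A * S₂ = E := by
  have hne : ∀ i j, i ≠ j → A j j ^ 2 - A i i ^ 2 ≠ 0 := fun i j hij h =>
    hij (hdist ((pow_left_inj₀ (hpos j).le (hpos i).le two_ne_zero).mp (sub_eq_zero.mp h))).symm
  refine ⟨?_, ?_, ?_⟩
  · ext i j
    rw [transpose_apply, neg_apply, hS₁, hS₁]
    by_cases hij : i = j
    · simp [hij]
    · have h₁ := hne i j hij
      have h₂ := hne j i (Ne.symm hij)
      rw [if_neg hij, if_neg (Ne.symm hij), ← neg_div, div_eq_div_iff h₂ h₁]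
      ring
  · ext i j
    rw [transpose_apply, neg_apply, hS₂, hS₂]
    by_cases hij : i = j
    · simp [hij]
    · have h₁ := hne i j hij
      have h₂ := hne j i (Ne.symm hij)
      rw [if_neg hij, if_neg (Ne.symm hij), neg_neg, ← neg_div, div_eq_div_iff h₂ h₁]
      ring
  · have hA : A = diagonal fun i => A i i := by
      ext i j
      by_cases hij : i = j
      · simp [hij]
      · rw [diagonal_apply_ne _ hij, hAdiag i j hij]
    ext i j
    have hentry : (S₁ * A + A * S₂) i j = S₁ i j * A j j + A i i * S₂ i j := by
      conv_lhs => rw [hA]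
      rw [Matrix.add_apply, mul_diagonal, diagonal_mul]
    rw [hentry, hS₁, hS₂]
    by_cases hij : i = j
    · simp [hij, hE]
    · have h₁ := hne i j hij
      rw [if_neg hij, if_neg hij]
      field_simp
      ring
end

section
/- Let J ∈ ℂ^{n×n} be the nilpotent Jordan block, i.e. J(i,j) = 1 if j = i + 1 and J(i,j) = 0 otherwise. Then for E ∈ ℂ^{n×n} the following are equivalent: (a) there exists B ∈ ℂ^{n×n} such that E = JB − BJ; (b) every subdiagonal of E, including the main diagonal, sums to zero, i.e. for every d with 0 ≤ d ≤ n − 1, the sum over i = 1, …, n − d of E(i + d, i) equals 0. -/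
open Matrix

/-- The entries of a square matrix, extended by zero to all pairs of natural numbers. -/
def Matrix.extendZero {n : ℕ} (A : Matrix (Fin n) (Fin n) ℂ) (i j : ℕ) : ℂ :=
  if h : i < n ∧ j < n then A ⟨i, h.1⟩ ⟨j, h.2⟩ else 0

theorem Matrix.extendZero_coe {n : ℕ} (A : Matrix (Fin n) (Fin n) ℂ) (i j : Fin n) :
    A.extendZero i j = A i j := by
  simp [Matrix.extendZero]

theorem Matrix.extendZero_of_le {n : ℕ} (A : Matrix (Fin n) (Fin n) ℂ) {i : ℕ} (j : ℕ)
    (hi : n ≤ i) : A.extendZero i j = 0 :=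
  dif_neg fun h => absurd h.1 (not_lt.mpr hi)

/-- Left multiplication by the nilpotent Jordan block shifts the rows up. -/
theorem jordan_mul_apply {n : ℕ} {J : Matrix (Fin n) (Fin n) ℂ}
    (hJ : ∀ i j, J i j = if (j : ℕ) = (i : ℕ) + 1 then 1 else 0)
    (B : Matrix (Fin n) (Fin n) ℂ) (i j : Fin n) :
    (J * B) i j = B.extendZero (i + 1) j := by
  simp only [Matrix.mul_apply, hJ, ite_mul, one_mul, zero_mul]
  by_cases h : (i : ℕ) + 1 < n
  · rw [Finset.sum_eq_single (⟨i + 1, h⟩ : Fin n)]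
    · simp [Matrix.extendZero, h]
    · intro k _ hk
      exact if_neg fun hki => hk (Fin.ext hki)
    · simp
  · rw [B.extendZero_of_le j (not_lt.mp h)]
    exact Finset.sum_eq_zero fun k _ => if_neg (by omega)

/-- Right multiplication by the nilpotent Jordan block shifts the columns to the right. -/
theorem mul_jordan_apply {n : ℕ} {J : Matrix (Fin n) (Fin n) ℂ}
    (hJ : ∀ i j, J i j = if (j : ℕ) = (i : ℕ) + 1 then 1 else 0)
    (B : Matrix (Fin n) (Fin n) ℂ) (i j : Fin n) :
    (B * J) i j = if (j : ℕ) = 0 then 0 else B.extendZero i (j - 1) := by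
  simp only [Matrix.mul_apply, hJ, mul_ite, mul_one, mul_zero]
  split_ifs with h
  · exact Finset.sum_eq_zero fun k _ => if_neg (by omega)
  · have hj : (j : ℕ) - 1 < n := by omega
    rw [Finset.sum_eq_single (⟨j - 1, hj⟩ : Fin n)]
    · rw [if_pos (by simp only; omega)]
      simp [Matrix.extendZero, hj]
    · intro k _ hk
      exact if_neg fun hkj => hk (Fin.ext (by simp only; omega))
    · simp

/-- The sum of the `d`-th subdiagonal as a sum over natural numbers. -/
theorem sum_subdiagonal_eq_sum_range {n d m : ℕ} (hn : n = d + m)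
    (E : Matrix (Fin n) (Fin n) ℂ) :
    (∑ i : Fin n, if h : (i : ℕ) + d < n then E ⟨(i : ℕ) + d, h⟩ i else 0) =
      ∑ i ∈ Finset.range m, E.extendZero (d + i) i := by
  have hterm : ∀ i : Fin n,
      (if h : (i : ℕ) + d < n then E ⟨(i : ℕ) + d, h⟩ i else 0) = E.extendZero (d + i) i := by
    intro i
    simp [Matrix.extendZero, add_comm d (i : ℕ)]
  rw [Finset.sum_congr rfl fun i _ => hterm i,
    Fin.sum_univ_eq_sum_range fun i => E.extendZero (d + i) i]
  refine (Finset.sum_subset (Finset.range_mono (by omega)) fun i _ hi => ?_).symm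
  exact E.extendZero_of_le i (by simp at hi; omega)

/-- The solution of `b (i + 1) j - b i (j - 1) = e i j` that vanishes in row zero, where
`b i (-1)` is read as zero. -/
def diagonalPartialSum (e : ℕ → ℕ → ℂ) : ℕ → ℕ → ℂ
  | 0, _ => 0
  | i + 1, 0 => e i 0
  | i + 1, j + 1 => e i (j + 1) + diagonalPartialSum e i j

theorem diagonalPartialSum_eq_sum (e : ℕ → ℕ → ℂ) (d m : ℕ) :
    diagonalPartialSum e (d + m + 1) m = ∑ i ∈ Finset.range (m + 1), e (d + i) i := by
  induction m with
  | zero => simp [diagonalPartialSum]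
  | succ m ih =>
    rw [Finset.sum_range_succ, ← ih]
    exact add_comm _ _

/-- a matrix `E` is a commutator `JB - BJ` with the nilpotent Jordan block
`J` iff every subdiagonal of `E` (including the main diagonal) sums to zero. -/
theorem stmt_16 {n : ℕ} (J E : Matrix (Fin n) (Fin n) ℂ)
    (hJ : ∀ i j, J i j = if (j : ℕ) = (i : ℕ) + 1 then 1 else 0) :
    (∃ B : Matrix (Fin n) (Fin n) ℂ, E = J * B - B * J) ↔
      ∀ d : ℕ, d < n →
        (∑ i : Fin n, if h : (i : ℕ) + d < n then E ⟨(i : ℕ) + d, h⟩ i else 0) = 0 := by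
  constructor
  · rintro ⟨B, hB⟩ d hd
    obtain ⟨m, hn⟩ := Nat.exists_eq_add_of_lt hd
    rw [sum_subdiagonal_eq_sum_range (m := m + 1) hn]
    let c : ℕ → ℂ := fun i => if i = 0 then 0 else B.extendZero (d + i) (i - 1)
    have hc : ∀ i ∈ Finset.range (m + 1), E.extendZero (d + i) i = c (i + 1) - c i := by
      intro i hi
      have hi' := Finset.mem_range.mp hi
      have h := E.extendZero_coe ⟨d + i, by omega⟩ ⟨i, by omega⟩
      rw [hB, Matrix.sub_apply, jordan_mul_apply hJ, mul_jordan_apply hJ, ← hB] at h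
      simpa [c, add_assoc] using h
    rw [Finset.sum_congr rfl hc, Finset.sum_range_sub]
    simp [c, B.extendZero_of_le m (i := d + (m + 1)) hn.le]
  · intro hE
    let b := diagonalPartialSum E.extendZero
    have hb : ∀ j, j < n → b n j = 0 := by
      intro j hj
      obtain ⟨d, hd⟩ := Nat.exists_eq_add_of_lt hj
      have hn : n = d + j + 1 := by omega
      have hsum := hE d (by omega)
      rw [sum_subdiagonal_eq_sum_range (m := j + 1) hn, ← diagonalPartialSum_eq_sum, ← hn] at hsum
      exact hsum
    let B : Matrix (Fin n) (Fin n) ℂ := Matrix.of fun i j => b i j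
    have hB : ∀ i j, i ≤ n → j < n → B.extendZero i j = b i j := by
      intro i j hi hj
      obtain hi | rfl := hi.lt_or_eq
      · simp [Matrix.extendZero, B, hi, hj]
      · rw [hb j hj, B.extendZero_of_le j le_rfl]
    refine ⟨B, Matrix.ext fun i j => ?_⟩
    rw [Matrix.sub_apply, jordan_mul_apply hJ, mul_jordan_apply hJ, hB _ _ i.2 j.2,
      hB _ _ i.2.le (by omega), ← E.extendZero_coe]
    obtain ⟨j, hj⟩ := j
    cases j <;> simp [b, diagonalPartialSum]
end

section
/- Let n ≥ 2 and let J ∈ ℂ^{n×n} be the nilpotent Jordan block, i.e. J(i,j) = 1 if j = i + 1 and J(i,j) = 0 otherwise. Let E ∈ ℂ^{n×n} satisfy E(n,1) = 0. Then the function ε ↦ det(J + εE) is a polynomial in ε whose coefficients of ε⁰ and ε¹ vanish, and whose coefficient of ε² equals (−1)ⁿ · Σ_{r=1}^{n−1} E(r,1) E(n, r+1). -/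
open Matrix Polynomial

/-- A scalar common to the last block row and the last block column of a bordered matrix with
one-dimensional border factors out of the determinant twice. -/
lemma det_fromBlocks_smul_smul_zero {R : Type*} [CommRing R] {m : ℕ}
    (A : Matrix (Fin m) (Fin m) R) (b : Matrix (Fin m) (Fin 1) R) (c : Matrix (Fin 1) (Fin m) R)
    (t : R) :
    (fromBlocks A (t • b) (t • c) 0).det = t ^ 2 * (fromBlocks A b c 0).det := by
  have h : fromBlocks A (t • b) (t • c) 0 =
      fromBlocks 1 0 0 (t • (1 : Matrix (Fin 1) (Fin 1) R)) * fromBlocks A b c 0 *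
        fromBlocks 1 0 0 (t • (1 : Matrix (Fin 1) (Fin 1) R)) := by
    simp [fromBlocks_multiply]
  rw [h, det_mul, det_mul, det_fromBlocks_zero₂₁]
  simp
  ring

/-- Moving the first column to the end turns a determinant of size `m + 1` into that of a block
matrix, up to the sign of a cycle. -/
lemma det_eq_neg_one_pow_mul_det_rotate {R : Type*} [CommRing R] {m : ℕ}
    (M : Matrix (Fin (m + 1)) (Fin (m + 1)) R) :
    M.det = (-1) ^ m * (fromBlocks (of fun i j : Fin m => M i.castSucc j.succ)
      (of fun (i : Fin m) (_ : Fin 1) => M i.castSucc 0)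
      (of fun (_ : Fin 1) (j : Fin m) => M (Fin.last m) j.succ)
      (of fun _ _ : Fin 1 => M (Fin.last m) 0)).det := by
  have hblock : fromBlocks (of fun i j : Fin m => M i.castSucc j.succ)
      (of fun (i : Fin m) (_ : Fin 1) => M i.castSucc 0)
      (of fun (_ : Fin 1) (j : Fin m) => M (Fin.last m) j.succ)
      (of fun _ _ : Fin 1 => M (Fin.last m) 0) =
      (M.submatrix id (finRotate (m + 1))).submatrix finSumFinEquiv finSumFinEquiv := by
    have hcast (i : Fin m) : Fin.castAdd 1 i = i.castSucc := rfl
    have hlast (i : Fin 1) : Fin.natAdd m i = Fin.last m := by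
      ext; simp
    have hrot (j : Fin m) : finRotate (m + 1) j.castSucc = j.succ := by
      simp
    ext (i | i) (j | j) <;>
      simp only [fromBlocks_apply₁₁, fromBlocks_apply₁₂, fromBlocks_apply₂₁, fromBlocks_apply₂₂,
        of_apply, submatrix_apply, id, finSumFinEquiv_apply_left, finSumFinEquiv_apply_right,
        hcast, hlast, hrot, finRotate_last]
  rw [hblock, det_submatrix_equiv_self, det_permute', sign_finRotate, ← mul_assoc]
  simp [← mul_pow]

/-- for the nilpotent Jordan block `J` and `E` with `E(n,1) = 0`,
`ε ↦ det(J + εE)` is a polynomial whose coefficients of `ε⁰` and `ε¹` vanish and whose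
coefficient of `ε²` is `(-1)ⁿ Σ_{r=1}^{n-1} E(r,1) E(n,r+1)` (indices 1-based). -/
theorem stmt_17 {n : ℕ} (hn : 2 ≤ n) (J E : Matrix (Fin n) (Fin n) ℂ)
    (hJ : ∀ i j, J i j = if (j : ℕ) = (i : ℕ) + 1 then 1 else 0)
    (hE : E ⟨n - 1, by omega⟩ ⟨0, by omega⟩ = 0) :
    ∃ p : Polynomial ℂ,
      (∀ ε : ℂ, (J + ε • E).det = p.eval ε) ∧
      p.coeff 0 = 0 ∧ p.coeff 1 = 0 ∧
      p.coeff 2 = (-1) ^ n *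
        ∑ r : Fin n, if h : (r : ℕ) + 1 < n then
          E r ⟨0, by omega⟩ * E ⟨n - 1, by omega⟩ ⟨(r : ℕ) + 1, h⟩ else 0 := by
  obtain ⟨m, rfl⟩ : ∃ m, n = m + 1 := ⟨n - 1, by omega⟩
  replace hE : E (Fin.last m) 0 = 0 := hE
  let A : Matrix (Fin m) (Fin m) ℂ := of fun i j => E i.castSucc j.succ
  let b : Matrix (Fin m) (Fin 1) ℂ := of fun i _ => E i.castSucc 0
  let c : Matrix (Fin 1) (Fin m) ℂ := of fun _ j => E (Fin.last m) j.succ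
  let q : ℂ[X] := (fromBlocks (1 + (X : ℂ[X]) • A.map C) (b.map C) (c.map C) 0).det
  have hq (ε : ℂ) : q.eval ε = (fromBlocks (1 + ε • A) b c 0).det := by
    rw [← coe_evalRingHom, RingHom.map_det]
    congr 1
    ext (i | i) (j | j) <;> simp [Matrix.one_apply, apply_ite (eval ε)]
    ring
  have hdet (ε : ℂ) : (J + ε • E).det = (-1) ^ m * (ε ^ 2 * q.eval ε) := by
    rw [det_eq_neg_one_pow_mul_det_rotate, hq, ← det_fromBlocks_smul_smul_zero]
    congr 3
    · ext i j
      simp [A, hJ, Matrix.one_apply, Fin.ext_iff, eq_comm]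
    · ext i j
      simp [b, hJ]
    · ext i j
      have := j.isLt
      simp [c, hJ, this.ne]
    · ext i j
      simp [hJ, hE]
  have hq0 : q.coeff 0 = -∑ r : Fin m, E r.castSucc 0 * E (Fin.last m) r.succ := by
    rw [coeff_zero_eq_eval_zero, hq, zero_smul, add_zero, det_fromBlocks_one₁₁]
    simp [b, c, Matrix.mul_apply, mul_comm]
  refine ⟨C ((-1) ^ m) * (q * X ^ 2), fun ε => ?_, ?_, ?_, ?_⟩
  · rw [hdet]
    simp [mul_comm]
  · rw [coeff_C_mul, coeff_mul_X_pow']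
    simp
  · rw [coeff_C_mul, coeff_mul_X_pow']
    simp
  · rw [coeff_C_mul, coeff_mul_X_pow', if_pos le_rfl, Nat.sub_self, hq0, Fin.sum_univ_castSucc,
      pow_succ]
    have hterm (r : Fin m) : (if h : (r.castSucc : ℕ) + 1 < m + 1 then
        E r.castSucc ⟨0, by omega⟩ * E ⟨m + 1 - 1, by omega⟩ ⟨(r.castSucc : ℕ) + 1, h⟩ else 0) =
        E r.castSucc 0 * E (Fin.last m) r.succ := by
      rw [dif_pos (by simp)]
      rfl
    simp only [hterm]
    simp
end
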